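/- Assume d_i > 0 for every i (so vol(V) > 0). Let x ∈ ℝⁿ, x ≠ 0, satisfy |x_i| = ‖x‖_∞ for every i. If there exists an index i with F(R_i x) > F(x), where R_i x flips the sign of the i-th coordinate of x, then there exists y ≠ 0 with ‖y/‖y‖_∞ − x/‖x‖_∞‖_∞ < 1/2 and F(y) > F(x). Equivalently: if x is a local maximizer of F on U(x) = {y ≠ 0 : ‖y/‖y‖_∞ − x/‖x‖_∞‖_∞ < 1/2}, then F(R_i x) ≤ F(x) for every i. -/

import Mathlib

open Finset

noncomputable section

/-- Degree `d_i = ∑_j w_{ij}`. -/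
def dvec (n : ℕ) (w : Fin n → Fin n → ℝ) (i : Fin n) : ℝ := ∑ j, w i j

/-- Volume of a vertex subset: `vol(A) = ∑_{i ∈ A} d_i`. -/
def vol (n : ℕ) (w : Fin n → Fin n → ℝ) (A : Finset (Fin n)) : ℝ := ∑ i ∈ A, dvec n w i

/-- Cut value: `cut(S) = ∑_{i ∈ S} ∑_{j ∉ S} w_{ij}`. -/
def cut (n : ℕ) (w : Fin n → Fin n → ℝ) (S : Finset (Fin n)) : ℝ := ∑ i ∈ S, ∑ j ∈ Sᶜ, w i j

/-- `I(x) = ∑_{i<j} w_{ij} |x_i - x_j|`. -/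
def Ifun (n : ℕ) (w : Fin n → Fin n → ℝ) (x : Fin n → ℝ) : ℝ :=
  ∑ i, ∑ j, if i < j then w i j * |x i - x j| else 0

/-- `N(x) = min_{c ∈ ℝ} ∑_i d_i |x_i - c|`. -/
def Nfun (n : ℕ) (d : Fin n → ℝ) (x : Fin n → ℝ) : ℝ :=
  sInf (Set.range fun c : ℝ => ∑ i, d i * |x i - c|)

/-- The anti-Cheeger objective `F(x) = I(x) / (2 vol(V) ‖x‖_∞ - N(x))`.
Note `‖x‖` on `Fin n → ℝ` is the sup norm `‖x‖_∞ = max_i |x_i|`. -/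
def Ffun (n : ℕ) (w : Fin n → Fin n → ℝ) (x : Fin n → ℝ) : ℝ :=
  Ifun n w x / (2 * vol n w univ * ‖x‖ - Nfun n (dvec n w) x)

/-- `Q_r(x) = (I(x) + r N(x)) / (2 vol(V))`. -/
def Qfun (n : ℕ) (w : Fin n → Fin n → ℝ) (r : ℝ) (x : Fin n → ℝ) : ℝ :=
  (Ifun n w x + r * Nfun n (dvec n w) x) / (2 * vol n w univ)

/-- The subdifferential of `f : ℝⁿ → ℝ` at `x`:
all `s` with `f y ≥ f x + ⟨s, y - x⟩` for all `y`. -/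
def subgrad (n : ℕ) (f : (Fin n → ℝ) → ℝ) (x : Fin n → ℝ) : Set (Fin n → ℝ) :=
  {s | ∀ y, f y ≥ f x + ∑ i, s i * (y i - x i)}

/-- `‖x‖_p = (∑_i |x_i|^p)^{1/p}`. -/
def pnorm (n : ℕ) (p : ℝ) (x : Fin n → ℝ) : ℝ := (∑ i, |x i| ^ p) ^ (1 / p)

open Function

lemma bddBelow_range_sum_mul_abs {n : ℕ} {d : Fin n → ℝ} (hd : ∀ i, 0 ≤ d i) (x : Fin n → ℝ) :
    BddBelow (Set.range fun c : ℝ => ∑ i, d i * |x i - c|) :=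
  ⟨0, by rintro _ ⟨c, rfl⟩; exact sum_nonneg fun i _ => mul_nonneg (hd i) (abs_nonneg _)⟩

lemma Nfun_le {n : ℕ} {d : Fin n → ℝ} (hd : ∀ i, 0 ≤ d i) (x : Fin n → ℝ) (c : ℝ) :
    Nfun n d x ≤ ∑ i, d i * |x i - c| :=
  csInf_le (bddBelow_range_sum_mul_abs hd x) ⟨c, rfl⟩

lemma Nfun_le_sum_mul_norm {n : ℕ} {d : Fin n → ℝ} (hd : ∀ i, 0 ≤ d i) (x : Fin n → ℝ) :
    Nfun n d x ≤ (∑ i, d i) * ‖x‖ := by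
  refine (Nfun_le hd x 0).trans ?_
  rw [sum_mul]
  refine sum_le_sum fun i _ => mul_le_mul_of_nonneg_left ?_ (hd i)
  simpa using norm_le_pi_norm x i

lemma Ifun_nonneg {n : ℕ} {w : Fin n → Fin n → ℝ} (hw : ∀ i j, 0 ≤ w i j) (x : Fin n → ℝ) :
    0 ≤ Ifun n w x := by
  refine sum_nonneg fun i _ => sum_nonneg fun j _ => ?_
  split_ifs
  · exact mul_nonneg (hw i j) (abs_nonneg _)
  · exact le_rfl

/-- Moving one coordinate of a two-valued vector towards its negative changes `I` affinely. -/
lemma Ifun_update_of_abs_eq {n : ℕ} (w : Fin n → Fin n → ℝ) {x : Fin n → ℝ} {M : ℝ} (hM : 0 ≤ M)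
    (hx : ∀ i, |x i| = M) (i : Fin n) :
    Ifun n w (update x i (3 / 4 * x i)) =
      7 / 8 * Ifun n w x + 1 / 8 * Ifun n w (update x i (-x i)) := by
  have term : ∀ a b : ℝ, |a| = M → |b| = M →
      |3 / 4 * a - b| = 7 / 8 * |a - b| + 1 / 8 * |-a - b| := by
    intro a b ha hb
    rcases (abs_eq hM).1 ha with rfl | rfl <;> rcases (abs_eq hM).1 hb with h | h <;> subst h <;>
      grind
  simp only [Ifun, mul_sum, ← sum_add_distrib]
  refine sum_congr rfl fun j _ => sum_congr rfl fun k _ => ?_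
  split_ifs with hjk
  · have key : |update x i (3 / 4 * x i) j - update x i (3 / 4 * x i) k| =
        7 / 8 * |x j - x k| + 1 / 8 * |update x i (-x i) j - update x i (-x i) k| := by
      by_cases hj : j = i
      · subst hj
        simpa [update_of_ne hjk.ne'] using term _ _ (hx j) (hx k)
      · by_cases hk : k = i
        · subst hk
          have h := term _ _ (hx k) (hx j)
          simp only [update_self, update_of_ne hj]
          rwa [abs_sub_comm (x j), abs_sub_comm (x j), abs_sub_comm (x j)]
        · simp only [update_of_ne hj, update_of_ne hk]
          ring
    rw [key]
    ring
  · simp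

/-- Moving one coordinate of a two-valued vector towards its negative keeps `N` above the chord. -/
lemma le_Nfun_update_of_abs_eq {n : ℕ} {d : Fin n → ℝ} (hd : ∀ i, 0 ≤ d i) {x : Fin n → ℝ}
    {M : ℝ} (hM : 0 ≤ M) (hx : ∀ i, |x i| = M) (i : Fin n) :
    7 / 8 * Nfun n d x + 1 / 8 * Nfun n d (update x i (-x i)) ≤
      Nfun n d (update x i (3 / 4 * x i)) := by
  refine le_csInf (Set.range_nonempty _) ?_
  rintro _ ⟨c, rfl⟩
  obtain ⟨c₀, c₁, hne, hi⟩ : ∃ c₀ c₁ : ℝ,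
      (∀ b, |b| = M → 7 / 8 * |b - c₀| + 1 / 8 * |b - c₁| ≤ |b - c|) ∧
      7 / 8 * |x i - c₀| + 1 / 8 * |-x i - c₁| ≤ |3 / 4 * x i - c| := by
    obtain ⟨e, he₁, he₂, hec⟩ : ∃ e, -M ≤ e ∧ e ≤ M ∧ ∀ b, |b| ≤ M → |b - e| ≤ |b - c| := by
      rcases le_total c (-M) with h | h
      · exact ⟨-M, by linarith, by linarith, fun b hb => by grind⟩
      · rcases le_total c M with h' | h'
        · exact ⟨c, h, h', fun b _ => le_rfl⟩
        · exact ⟨M, by linarith, by linarith, fun b hb => by grind⟩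
    suffices h : ∃ c₀ c₁ : ℝ, (-M ≤ c₀ ∧ c₀ ≤ M) ∧ (-M ≤ c₁ ∧ c₁ ≤ M) ∧
        7 / 8 * c₀ + 1 / 8 * c₁ = e ∧
        7 / 8 * |x i - c₀| + 1 / 8 * |-x i - c₁| ≤ |3 / 4 * x i - e| by
      obtain ⟨c₀, c₁, ⟨h₁, h₂⟩, ⟨h₃, h₄⟩, h₅, h₆⟩ := h
      refine ⟨c₀, c₁, fun b hb => ?_, h₆.trans (hec _ ?_)⟩
      · refine le_trans ?_ (hec b hb.le)
        rcases (abs_eq hM).1 hb with h | h <;> subst h <;> grind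
      · rw [abs_mul, hx i]
        norm_num
        linarith
    rcases (abs_eq hM).1 (hx i) with h | h <;> rw [h]
    · rcases le_total e (3 / 4 * M) with h' | h'
      · refine ⟨(8 * e + M) / 7, -M, ?_, ?_, ?_, ?_⟩ <;> grind
      · refine ⟨M, 8 * e - 7 * M, ?_, ?_, ?_, ?_⟩ <;> grind
    · rcases le_total e (-(3 / 4 * M)) with h' | h'
      · refine ⟨-M, 8 * e + 7 * M, ?_, ?_, ?_, ?_⟩ <;> grind
      · refine ⟨(8 * e - M) / 7, M, ?_, ?_, ?_, ?_⟩ <;> grind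
  have h₀ := Nfun_le hd x c₀
  have h₁ := Nfun_le hd (update x i (-x i)) c₁
  have hsum : 7 / 8 * ∑ j, d j * |x j - c₀| + 1 / 8 * ∑ j, d j * |update x i (-x i) j - c₁| ≤
      ∑ j, d j * |update x i (3 / 4 * x i) j - c| := by
    simp only [mul_sum, ← sum_add_distrib]
    refine sum_le_sum fun j _ => ?_
    by_cases hj : j = i
    · subst hj
      simp only [update_self]
      linarith [mul_le_mul_of_nonneg_left hi (hd j)]
    · simp only [update_of_ne hj]
      linarith [mul_le_mul_of_nonneg_left (hne _ (hx j)) (hd j)]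
  show _ ≤ ∑ j, d j * |update x i (3 / 4 * x i) j - c|
  linarith

lemma norm_update_of_abs_eq {n : ℕ} {x : Fin n → ℝ} (hx : ∀ i, |x i| = ‖x‖) {i j : Fin n}
    (hj : j ≠ i) {a : ℝ} (ha : |a| ≤ ‖x‖) : ‖update x i a‖ = ‖x‖ := by
  refine le_antisymm ((pi_norm_le_iff_of_nonneg (norm_nonneg _)).2 fun k => ?_) ?_
  · by_cases hk : k = i
    · subst hk
      simpa using ha
    · simpa [update_of_ne hk] using (hx k).le
  · have h := norm_le_pi_norm (update x i a) j
    rw [update_of_ne hj, Real.norm_eq_abs, hx j] at h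
    exact h

/-- if `|x_i| = ‖x‖_∞` for all `i` and some single sign flip strictly
increases `F`, then `F` takes a strictly larger value somewhere in the neighborhood
`U(x) = {y ≠ 0 : ‖y/‖y‖_∞ - x/‖x‖_∞‖_∞ < 1/2}`. -/
theorem stmt19 (n : ℕ) (hn : 1 ≤ n) (w : Fin n → Fin n → ℝ)
    (hsymm : ∀ i j, w i j = w j i) (hnn : ∀ i j, 0 ≤ w i j)
    (hdiag : ∀ i, w i i = 0) (hd : ∀ i, 0 < dvec n w i)
    (x : Fin n → ℝ) (hx : x ≠ 0) (hxall : ∀ i, |x i| = ‖x‖)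
    (hflip : ∃ i : Fin n, Ffun n w x < Ffun n w (Function.update x i (-x i))) :
    ∃ y : Fin n → ℝ, y ≠ 0 ∧ ‖‖y‖⁻¹ • y - ‖x‖⁻¹ • x‖ < 1 / 2 ∧
      Ffun n w x < Ffun n w y := by
  obtain ⟨i, hi⟩ := hflip
  have hM : 0 < ‖x‖ := norm_pos_iff.2 hx
  obtain ⟨j, hj⟩ : ∃ j, j ≠ i := by
    by_contra! h
    refine (hd i).ne' (sum_eq_zero fun j _ => ?_)
    rw [h j, hdiag]
  have hd' : ∀ k, 0 ≤ dvec n w k := fun k => (hd k).le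
  have hV : 0 < vol n w univ := sum_pos (fun k _ => hd k) ⟨i, mem_univ i⟩
  have hI := Ifun_update_of_abs_eq w hM.le hxall i
  have hN := le_Nfun_update_of_abs_eq hd' hM.le hxall i
  have hflipnorm : ‖update x i (-x i)‖ = ‖x‖ :=
    norm_update_of_abs_eq hxall hj (by rw [abs_neg, hxall])
  have hynorm : ‖update x i (3 / 4 * x i)‖ = ‖x‖ := by
    refine norm_update_of_abs_eq hxall hj ?_
    rw [abs_mul, hxall]
    norm_num
    linarith
  have hpos : ∀ z : Fin n → ℝ, ‖z‖ = ‖x‖ →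
      0 < 2 * vol n w univ * ‖x‖ - Nfun n (dvec n w) z := by
    intro z hz
    have h := Nfun_le_sum_mul_norm hd' z
    rw [hz] at h
    change _ ≤ vol n w univ * ‖x‖ at h
    linarith [mul_pos hV hM]
  refine ⟨update x i (3 / 4 * x i), norm_pos_iff.1 (hynorm ▸ hM), ?_, ?_⟩
  · have hdist : ‖update x i (3 / 4 * x i) - x‖ ≤ 1 / 4 * ‖x‖ := by
      refine (pi_norm_le_iff_of_nonneg (by positivity)).2 fun k => ?_
      by_cases hk : k = i
      · subst hk
        rw [Pi.sub_apply, update_self, Real.norm_eq_abs,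
          show 3 / 4 * x k - x k = -(1 / 4 * x k) by ring, abs_neg, abs_mul, hxall]
        norm_num
      · simp [update_of_ne hk]
    rw [hynorm, ← smul_sub, norm_smul, norm_inv, norm_norm, inv_mul_lt_iff₀ hM]
    linarith
  · unfold Ffun at hi ⊢
    rw [hflipnorm, div_lt_div_iff₀ (hpos x rfl) (hpos _ hflipnorm)] at hi
    rw [hynorm, div_lt_div_iff₀ (hpos x rfl) (hpos _ hynorm), hI]
    linarith [mul_le_mul_of_nonneg_left hN (Ifun_nonneg hnn x)]
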